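/- Let S be a saturated numerical semigroup and let x ∈ S with x ≠ 0. Then S \ {x} is a saturated numerical semigroup if and only if d_S(y) ≠ d_S(x) for every y ∈ S\{0} with y < x. -/

import Mathlib

/-- A numerical semigroup: subset of ℕ containing 0, closed under addition,
with finite complement. -/
def IsNumericalSemigroup (S : Set ℕ) : Prop :=
  0 ∈ S ∧ (∀ a ∈ S, ∀ b ∈ S, a + b ∈ S) ∧ Sᶜ.Finite

/-- `dOf S s = gcd {x ∈ S : x ≤ s}`. -/
noncomputable def dOf (S : Set ℕ) (s : ℕ) : ℕ :=
  letI := Classical.decPred (· ∈ S)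
  ((Finset.range (s + 1)).filter (· ∈ S)).gcd id

/-- A saturated numerical semigroup. -/
def IsSaturatedNS (S : Set ℕ) : Prop :=
  IsNumericalSemigroup S ∧ ∀ s ∈ S, s ≠ 0 → s + dOf S s ∈ S

/-- `Sat F`: saturated numerical semigroups with Frobenius number `F`. -/
def SatF (F : ℕ) : Set (Set ℕ) :=
  {S | IsSaturatedNS S ∧ F ∉ S ∧ ∀ x, x ∉ S → x ≤ F}

/-- Multiplicity: least nonzero element. -/
noncomputable def multOf (S : Set ℕ) : ℕ := sInf {x | x ∈ S ∧ x ≠ 0}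

/-- Pseudo-Frobenius numbers. -/
def PFset (S : Set ℕ) : Set ℕ := {z | z ∉ S ∧ ∀ s ∈ S, s ≠ 0 → z + s ∈ S}

/-- Special gaps. -/
def SGset (S : Set ℕ) : Set ℕ := {x | x ∈ PFset S ∧ 2 * x ∈ S}

/-- `TSet a b = ⟨a⟩ ∪ {x : x ≥ b}`. -/
def TSet (a b : ℕ) : Set ℕ := {x | a ∣ x} ∪ {x | b ≤ x}

/-- A `Sat(F)`-set. -/
def SatFSet (F : ℕ) (X : Set ℕ) : Prop :=
  X ∩ ({0} ∪ {x | F + 1 ≤ x}) = ∅ ∧ ∃ S ∈ SatF F, X ⊆ S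

/-- `Sat(F)[X]`: intersection of all elements of `Sat F` containing `X`. -/
def SatClosure (F : ℕ) (X : Set ℕ) : Set ℕ := ⋂₀ {S | S ∈ SatF F ∧ X ⊆ S}

/-- `X` is a minimal `Sat(F)`-system of generators of `S`. -/
def IsMinSatGen (F : ℕ) (X S : Set ℕ) : Prop :=
  SatFSet F X ∧ SatClosure F X = S ∧ ∀ Y : Set ℕ, Y ⊂ X → SatClosure F Y ≠ S

/-- The `Sat(F)`-rank of `S`: minimal cardinality of a `Sat(F)`-set `X`
with `Sat(F)[X] = S`. -/
noncomputable def SatRank (F : ℕ) (S : Set ℕ) : ℕ :=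
  sInf {k | ∃ X : Set ℕ, SatFSet F X ∧ SatClosure F X = S ∧ X.ncard = k}

theorem dvd_dOf_iff {S : Set ℕ} {n s : ℕ} :
    n ∣ dOf S s ↔ ∀ t ∈ S, t ≤ s → n ∣ t := by
  simp only [dOf, Finset.dvd_gcd_iff, Finset.mem_filter, Finset.mem_range, id, Nat.lt_succ_iff]
  exact ⟨fun h t ht hts => h t ⟨hts, ht⟩, fun h t ht => h t ht.2 ht.1⟩

theorem dOf_dvd {S : Set ℕ} {t s : ℕ} (ht : t ∈ S) (hts : t ≤ s) : dOf S s ∣ t :=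
  dvd_dOf_iff.1 dvd_rfl t ht hts

theorem dOf_dvd_dOf {S T : Set ℕ} {s t : ℕ} (hST : S ⊆ T) (hst : s ≤ t) :
    dOf T t ∣ dOf S s :=
  dvd_dOf_iff.2 fun _ hu hus => dOf_dvd (hST hu) (hus.trans hst)

theorem dOf_diff_singleton_of_lt {S : Set ℕ} {x s : ℕ} (hsx : s < x) :
    dOf (S \ {x}) s = dOf S s :=
  Nat.dvd_antisymm
    (dvd_dOf_iff.2 fun _ ht hts => dOf_dvd ⟨ht, (hts.trans_lt hsx).ne⟩ hts)
    (dOf_dvd_dOf Set.sdiff_subset le_rfl)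

/-- A saturated numerical semigroup absorbs every multiple of `dOf S s` above `s`. -/
theorem IsSaturatedNS.add_mem_of_dOf_dvd {S : Set ℕ} (hS : IsSaturatedNS S) (m : ℕ) :
    ∀ s ∈ S, s ≠ 0 → dOf S s ∣ m → s + m ∈ S := by
  induction m using Nat.strong_induction_on with
  | _ m ih =>
    intro s hs hs0 hdvd
    rcases Nat.eq_zero_or_pos m with rfl | hm
    · simpa using hs
    have hle := Nat.le_of_dvd hm hdvd
    have hpos : 0 < dOf S s := Nat.pos_of_dvd_of_pos (dOf_dvd hs le_rfl) (Nat.pos_of_ne_zero hs0)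
    have h := ih (m - dOf S s) (by omega) (s + dOf S s) (hS.2 s hs hs0) (by omega)
      ((dOf_dvd_dOf subset_rfl (Nat.le_add_right _ _)).trans (Nat.dvd_sub hdvd dvd_rfl))
    rwa [show s + dOf S s + (m - dOf S s) = s + m by omega] at h

theorem exists_lt_dOf_eq_of_dOf_dvd {S : Set ℕ} {x z : ℕ} (hz : z ∈ S) (hz0 : z ≠ 0)
    (hzx : z < x) (hdvd : dOf S z ∣ x) :
    ∃ y ∈ S, y ≠ 0 ∧ y < x ∧ dOf S y = dOf S x := by
  induction hk : x - z using Nat.strong_induction_on generalizing z with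
  | _ k ih =>
    by_cases h : dOf S z ∣ dOf S x
    · exact ⟨z, hz, hz0, hzx, Nat.dvd_antisymm h (dOf_dvd_dOf subset_rfl hzx.le)⟩
    · rw [dvd_dOf_iff] at h
      push Not at h
      obtain ⟨w, hw, hwx, hndvd⟩ := h
      have hzw : z < w := by
        by_contra! hwz
        exact hndvd (dOf_dvd hw hwz)
      have hne : w ≠ x := by
        rintro rfl
        exact hndvd hdvd
      exact ih (x - w) (by omega) hw (by omega) (by omega)
        ((dOf_dvd_dOf subset_rfl hzw.le).trans hdvd) rfl

/-- for a saturated numerical semigroup `S` and `x ∈ S \ {0}`,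
`S \ {x}` is a saturated numerical semigroup iff `d_S(y) ≠ d_S(x)` for all
`y ∈ S \ {0}` with `y < x`. -/
theorem saturated_diff_singleton_iff (S : Set ℕ) (hS : IsSaturatedNS S)
    (x : ℕ) (hx : x ∈ S) (hx0 : x ≠ 0) :
    IsSaturatedNS (S \ {x}) ↔
      ∀ y ∈ S, y ≠ 0 → y < x → dOf S y ≠ dOf S x := by
  constructor
  · intro hT y hy hy0 hyx hd
    have hdvd : dOf (S \ {x}) y ∣ x - y := by
      rw [dOf_diff_singleton_of_lt hyx]
      exact Nat.dvd_sub (hd ▸ dOf_dvd hx le_rfl) (dOf_dvd hy le_rfl)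
    have h := hT.add_mem_of_dOf_dvd (x - y) y ⟨hy, hyx.ne⟩ hy0 hdvd
    rw [Nat.add_sub_cancel' hyx.le] at h
    exact h.2 rfl
  · intro h
    have hndvd : ∀ z ∈ S, z ≠ 0 → z < x → ¬ dOf S z ∣ x := fun z hz hz0 hzx hdvd => by
      obtain ⟨y, hy, hy0, hyx, hd⟩ := exists_lt_dOf_eq_of_dOf_dvd hz hz0 hzx hdvd
      exact h y hy hy0 hyx hd
    refine ⟨⟨⟨hS.1.1, hx0.symm⟩, ?_, ?_⟩, ?_⟩
    · rintro a ⟨ha, hax⟩ b ⟨hb, hbx⟩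
      refine ⟨hS.1.2.1 a ha b hb, fun hab => ?_⟩
      simp only [Set.mem_singleton_iff] at hax hbx hab
      rcases le_total a b with hle | hle
      · exact hndvd b hb (by omega) (by omega)
          (hab ▸ dvd_add (dOf_dvd ha hle) (dOf_dvd hb le_rfl))
      · exact hndvd a ha (by omega) (by omega)
          (hab ▸ dvd_add (dOf_dvd ha le_rfl) (dOf_dvd hb hle))
    · rw [Set.sdiff_eq, Set.compl_inter, compl_compl]
      exact hS.1.2.2.union (Set.finite_singleton x)
    · rintro s ⟨hs, hsx⟩ hs0
      rcases lt_or_gt_of_ne hsx with hlt | hgt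
      · rw [dOf_diff_singleton_of_lt hlt]
        refine ⟨hS.2 s hs hs0, fun heq => hndvd s hs hs0 hlt ?_⟩
        rw [Set.mem_singleton_iff] at heq
        have hdvd : dOf S s ∣ s + dOf S s := dvd_add (dOf_dvd hs le_rfl) dvd_rfl
        rwa [heq] at hdvd
      · exact ⟨hS.add_mem_of_dOf_dvd _ s hs hs0 (dOf_dvd_dOf Set.sdiff_subset le_rfl),
          (Nat.lt_add_right _ hgt).ne'⟩
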